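/- arXiv:1412.8240 — 2 statements merged into one kernel-verified Lean document; each statement's English description precedes it below -/
import Mathlib

section
/- Let (X, φ) be a partial dynamical system (X locally compact Hausdorff, Δ ⊆ X open, φ : Δ → X continuous proper) and Y ⊆ X a closed set with X ∖ φ(Δ) ⊆ Y, and let (X̃, φ̃) be the reversible Y-extension with domain Δ̃. Then φ̃ is free — i.e. for every closed subset V ⊆ X̃ that is invariant (φ̃(V ∩ Δ̃) = V ∩ φ̃(Δ̃)), the restriction of φ̃ to V is topologically free — if and only if φ has no periodic points, i.e. there are no n ≥ 1 and x in the domain of φⁿ with φⁿ(x) = x. -/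
/-! Reversible `Y`-extension of a partial dynamical system `(X, φ)`.
The ambient space is `ℕ → X ⊕ Unit`, with `Sum.inr ()` playing the role of the isolated
point `0` of the disjoint union `X ⊔ {0}`, and the product topology. -/

/-- The set `X_N` of finite chains `(x₀, …, x_N, 0, 0, …)` with `x_n ∈ Δ`,
`φ(x_n) = x_{n-1}` for `1 ≤ n ≤ N`, and `x_N ∈ Y`. -/
def XFin {X : Type*} (Δ : Set X) (φ : Δ → X) (Y : Set X) (N : ℕ) :
    Set (ℕ → X ⊕ Unit) :=
  {f | ∃ x : ℕ → X, (∀ n ≤ N, f n = Sum.inl (x n)) ∧ (∀ n, N < n → f n = Sum.inr ()) ∧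
        (∀ n, 1 ≤ n → n ≤ N → ∃ h : x n ∈ Δ, φ ⟨x n, h⟩ = x (n - 1)) ∧ x N ∈ Y}

/-- The set `X_∞` of infinite chains `(x₀, x₁, …)` with `x_n ∈ Δ`, `φ(x_n) = x_{n-1}`. -/
def XInfSet {X : Type*} (Δ : Set X) (φ : Δ → X) : Set (ℕ → X ⊕ Unit) :=
  {f | ∃ x : ℕ → X, (∀ n, f n = Sum.inl (x n)) ∧
        ∀ n, 1 ≤ n → ∃ h : x n ∈ Δ, φ ⟨x n, h⟩ = x (n - 1)}

/-- The space `X̃ = (⋃ N, X_N) ∪ X_∞` of the reversible `Y`-extension, carrying the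
subspace topology of the product topology. -/
def XExt {X : Type*} (Δ : Set X) (φ : Δ → X) (Y : Set X) : Set (ℕ → X ⊕ Unit) :=
  (⋃ N, XFin Δ φ Y N) ∪ XInfSet Δ φ

open Classical in
/-- The ambient extension of the map `φ̃(x₀, x₁, …) = (φ(x₀), x₀, x₁, …)`. -/
noncomputable def phiT {X : Type*} (Δ : Set X) (φ : Δ → X) (f : ℕ → X ⊕ Unit) :
    ℕ → X ⊕ Unit :=
  fun n =>
    match n with
    | 0 =>
      match f 0 with
      | Sum.inl x => if h : x ∈ Δ then Sum.inl (φ ⟨x, h⟩) else Sum.inr ()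
      | Sum.inr _ => Sum.inr ()
    | Nat.succ m => f m


/-- The bi-infinite unfolding of an `n`-periodic orbit `orb`, read backwards from time `k`:
since `n - 1` steps forward amount to one step backward, it is `(orb k, orb (k - 1), …)`. -/
def backwardOrbit {X : Type*} (orb : ℕ → X) (n k : ℕ) : ℕ → X ⊕ Unit :=
  fun j => Sum.inl (orb (k + j * (n - 1)))

theorem backwardOrbit_mem_XExt {X : Type*} {Δ : Set X} {φ : Δ → X} (Y : Set X) {orb : ℕ → X}
    {n : ℕ} (hn : 1 ≤ n) (horb : ∀ i, ∃ h : orb i ∈ Δ, φ ⟨orb i, h⟩ = orb (i + 1))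
    (hper : Function.Periodic orb n) (k : ℕ) : backwardOrbit orb n k ∈ XExt Δ φ Y := by
  refine Or.inr ⟨fun j => orb (k + j * (n - 1)), fun _ => rfl, fun j hj => ?_⟩
  obtain ⟨h, e⟩ := horb (k + j * (n - 1))
  refine ⟨h, e.trans ?_⟩
  obtain ⟨m, rfl⟩ := Nat.exists_eq_add_of_le' hj
  obtain ⟨p, rfl⟩ := Nat.exists_eq_add_of_le' hn
  simp only [Nat.add_sub_cancel]
  rw [← hper (k + m * p)]
  congr 1
  ring

theorem phiT_backwardOrbit {X : Type*} {Δ : Set X} {φ : Δ → X} {orb : ℕ → X}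
    {n : ℕ} (hn : 1 ≤ n) (horb : ∀ i, ∃ h : orb i ∈ Δ, φ ⟨orb i, h⟩ = orb (i + 1))
    (hper : Function.Periodic orb n) (k : ℕ) :
    phiT Δ φ (backwardOrbit orb n k) = backwardOrbit orb n (k + 1) := by
  funext j
  cases j with
  | zero =>
    obtain ⟨h, e⟩ := horb k
    simp [phiT, backwardOrbit, h, e]
  | succ m =>
    obtain ⟨p, rfl⟩ := Nat.exists_eq_add_of_le' hn
    simp only [phiT, backwardOrbit, Nat.add_sub_cancel]
    rw [← hper (k + m * p)]
    congr 2
    ring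

theorem periodic_backwardOrbit {X : Type*} {orb : ℕ → X} {n : ℕ}
    (hper : Function.Periodic orb n) : Function.Periodic (backwardOrbit orb n) n := by
  intro k
  funext j
  simp only [backwardOrbit]
  rw [← hper (k + j * (n - 1))]
  congr 2
  ring

theorem periodic_of_orbit {X : Type*} {Δ : Set X} {φ : Δ → X} {orb : ℕ → X} {n : ℕ}
    (horb : ∀ i, ∃ h : orb i ∈ Δ, φ ⟨orb i, h⟩ = orb (i + 1)) (h0 : orb n = orb 0) :
    Function.Periodic orb n := by
  intro i
  induction i with
  | zero => simpa using h0
  | succ i ih =>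
    obtain ⟨h, e⟩ := horb i
    obtain ⟨h', e'⟩ := horb (i + n)
    rw [show i + 1 + n = i + n + 1 by ring, ← e, ← e']
    congr 2

/-- The extended map `φ̃` is free — i.e. for every closed invariant
`V ⊆ X̃` (invariance: `φ̃(V ∩ Δ̃) = V ∩ φ̃(Δ̃)`) the restriction of `φ̃` to `V` is
topologically free — if and only if `φ` has no periodic points. Here `Δ̃` is encoded by
`{f : x₀(f) ∈ Δ}`, periodic points of period `n` of the restriction of `φ̃` to `V` via
trajectories staying in `V`, and "empty interior in the subspace `V`" via open sets `U` of
`X̃` with `U ∩ V` contained in the periodic set. -/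
theorem stmt15 {X : Type*} [TopologicalSpace X] [LocallyCompactSpace X] [T2Space X]
    (Δ : Set X) (hΔ : IsOpen Δ) (φ : Δ → X) (hφc : Continuous φ)
    (hφp : ∀ K : Set X, IsCompact K → IsCompact (φ ⁻¹' K))
    (Y : Set X) (hYc : IsClosed Y) (hY : ∀ x : X, x ∉ Set.range φ → x ∈ Y) :
    -- `φ̃` is free ...
    (∀ V : Set (XExt Δ φ Y), IsClosed V →
      -- `V` is invariant: `φ̃(V ∩ Δ̃) = V ∩ φ̃(Δ̃)`
      ({g : XExt Δ φ Y | ∃ f : XExt Δ φ Y,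
          (f ∈ V ∧ ∃ x ∈ Δ, (f : ℕ → X ⊕ Unit) 0 = Sum.inl x) ∧
          phiT Δ φ (f : ℕ → X ⊕ Unit) = (g : ℕ → X ⊕ Unit)} =
        V ∩ {g : XExt Δ φ Y | ∃ f : XExt Δ φ Y,
          (∃ x ∈ Δ, (f : ℕ → X ⊕ Unit) 0 = Sum.inl x) ∧
          phiT Δ φ (f : ℕ → X ⊕ Unit) = (g : ℕ → X ⊕ Unit)}) →
      -- the restriction of `φ̃` to `V` is topologically free
      ∀ n : ℕ, 1 ≤ n → ∀ U : Set (XExt Δ φ Y), IsOpen U →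
        (∀ f ∈ U ∩ V, ∃ orb : ℕ → XExt Δ φ Y, (∀ i : ℕ, orb i ∈ V) ∧
          orb 0 = f ∧ orb n = f ∧
          ∀ i : ℕ,
            (∃ x ∈ Δ, ((orb i : XExt Δ φ Y) : ℕ → X ⊕ Unit) 0 = Sum.inl x) ∧
            phiT Δ φ ((orb i : XExt Δ φ Y) : ℕ → X ⊕ Unit) =
              ((orb (i + 1) : XExt Δ φ Y) : ℕ → X ⊕ Unit)) →
        U ∩ V = ∅)
    ↔ -- ... iff `φ` has no periodic points
    ¬∃ n : ℕ, 1 ≤ n ∧ ∃ x : X, ∃ orb : ℕ → X, orb 0 = x ∧ orb n = x ∧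
      ∀ i : ℕ, ∃ h : orb i ∈ Δ, φ ⟨orb i, h⟩ = orb (i + 1) := by
  constructor
  · rintro hfree ⟨n, hn, x, orb, h0, hx, horb⟩
    have hper : Function.Periodic orb n := periodic_of_orbit horb (hx.trans h0.symm)
    let p : ℕ → XExt Δ φ Y := fun k =>
      ⟨backwardOrbit orb n k, backwardOrbit_mem_XExt Y hn horb hper k⟩
    have hp : Function.Periodic p n := fun k => Subtype.ext (periodic_backwardOrbit hper k)
    have hstep (k : ℕ) : phiT Δ φ (p k : ℕ → X ⊕ Unit) = p (k + 1) :=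
      phiT_backwardOrbit hn horb hper k
    have hdom (k : ℕ) : ∃ x ∈ Δ, (p k : ℕ → X ⊕ Unit) 0 = Sum.inl x :=
      ⟨orb k, (horb k).1, by simp [p, backwardOrbit]⟩
    have hfin : (Set.range p).Finite := by
      refine ((Set.finite_Iio n).image p).subset ?_
      rintro _ ⟨k, rfl⟩
      exact ⟨k % n, Nat.mod_lt k hn, hp.map_mod_nat k⟩
    have hempty := hfree (Set.range p) hfin.isClosed ?_ n hn Set.univ isOpen_univ ?_
    · rw [Set.univ_inter] at hempty
      exact Set.range_nonempty p |>.ne_empty hempty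
    · ext g
      constructor
      · rintro ⟨_, ⟨⟨k, rfl⟩, hk⟩, hg⟩
        exact ⟨⟨k + 1, Subtype.ext ((hstep k).symm.trans hg)⟩, p k, hk, hg⟩
      · rintro ⟨⟨k, rfl⟩, -⟩
        refine ⟨p (k + (n - 1)), ⟨⟨_, rfl⟩, hdom _⟩, ?_⟩
        rw [hstep, show k + (n - 1) + 1 = k + n by omega, hp k]
    · rintro _ ⟨-, k, rfl⟩
      exact ⟨fun i => p (k + i), fun i => ⟨_, rfl⟩, rfl, hp k, fun i => ⟨hdom _, hstep _⟩⟩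
  · intro hno V _ _ n hn U _ hU
    refine Set.eq_empty_of_forall_notMem fun f hf => hno ?_
    obtain ⟨orb, -, h0, hn', horb⟩ := hU f hf
    choose x hxΔ hx using fun i => (horb i).1
    refine ⟨n, hn, x 0, x, rfl, Sum.inl_injective (β := Unit) ?_, fun i => ⟨hxΔ i, ?_⟩⟩
    · rw [← hx, ← hx, h0, hn']
    · have h := congrFun (horb i).2 0
      rw [hx (i + 1)] at h
      simpa [phiT, hx i, hxΔ i] using h
end

section
/- Let n ≥ 2 and let m₂, …, m_n be integers. Define the group homomorphism δ : ℤ^{n−1} → ℤⁿ by δ(k₁, …, k_{n−1}) = (0, k₂ − m₂k₁, k₃ − m₃k₂, …, k_{n−1} − m_{n−1}k_{n−2}, −m_n k_{n−1}) (for n = 2 this reads δ(k₁) = (0, −m₂k₁)). Then: (1) if m_i = 0 for some i ∈ {2, …, n}, then ker δ is isomorphic to ℤ, and otherwise ker δ = 0; (2) if m_i ≠ 0 for all i ∈ {2, …, n}, then the cokernel ℤⁿ / δ(ℤ^{n−1}) is isomorphic to ℤ ⊕ ℤ/(m₂m₃⋯m_n)ℤ, while if m_i = 0 for some i then the cokernel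 is isomorphic to ℤ². -/
open scoped Classical

/-- The extension by zero of a finite integer vector to a sequence. -/
def zeroExtend {N : ℕ} (k : Fin N → ℤ) (i : ℕ) : ℤ :=
  if h : i < N then k ⟨i, h⟩ else 0

theorem zeroExtend_val {N : ℕ} (k : Fin N → ℤ) (i : Fin N) : zeroExtend k i = k i := by
  simp [zeroExtend]

theorem zeroExtend_of_le {N : ℕ} (k : Fin N → ℤ) {i : ℕ} (h : N ≤ i) : zeroExtend k i = 0 := by
  simp [zeroExtend, h]

theorem zeroExtend_add {N : ℕ} (k l : Fin N → ℤ) :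
    zeroExtend (k + l) = zeroExtend k + zeroExtend l := by
  funext i
  simp only [zeroExtend, Pi.add_apply]
  split_ifs <;> simp

theorem prod_range_zeroExtend {N : ℕ} (m : Fin N → ℤ) :
    ∏ i ∈ Finset.range N, zeroExtend m i = ∏ i, m i := by
  rw [← Fin.prod_univ_eq_prod_range]
  simp [zeroExtend_val]

/-- The solution `K` of the recurrence `K (j + 1) = X (j + 1) + M j * K j` with `K 0 = c`. -/
def affineRec (M X : ℕ → ℤ) (c : ℤ) : ℕ → ℤ
  | 0 => c
  | j + 1 => X (j + 1) + M j * affineRec M X c j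

theorem affineRec_eq (M X : ℕ → ℤ) (c : ℤ) (j : ℕ) :
    affineRec M X c j = c * ∏ i ∈ Finset.range j, M i + affineRec M X 0 j := by
  induction j with
  | zero => simp [affineRec]
  | succ j ih =>
    rw [affineRec, ih, affineRec, Finset.prod_range_succ]
    ring

theorem affineRec_add (M X Y : ℕ → ℤ) (j : ℕ) :
    affineRec M (X + Y) 0 j = affineRec M X 0 j + affineRec M Y 0 j := by
  induction j with
  | zero => simp [affineRec]
  | succ j ih =>
    simp only [affineRec, ih, Pi.add_apply]
    ring

theorem affineRec_eq_zero (M X : ℕ → ℤ) (j : ℕ) (hX : ∀ i < j, X (i + 1) = 0) :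
    affineRec M X 0 j = 0 := by
  induction j with
  | zero => rfl
  | succ j ih =>
    rw [affineRec, ih fun i hi => hX i (by omega), hX j (by omega)]
    simp

theorem recurrence_iff_eq_affineRec (M X K : ℕ → ℤ) (N : ℕ) :
    (∀ j < N, X (j + 1) = K (j + 1) - M j * K j) ↔
      ∀ j ≤ N, K j = affineRec M X (K 0) j := by
  constructor
  · intro h j
    induction j with
    | zero => intro _; rfl
    | succ j ih =>
      intro hj
      rw [affineRec, ← ih (by omega), h j (by omega)]
      ring
  · intro h j hj
    rw [h (j + 1) (by omega), affineRec, ← h j (by omega)]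
    ring

/-- The map `x ↦ (x₀, ∑ⱼ x_j m_j ⋯ m_{N-1})`, the sum being over `1 ≤ j ≤ N` and taken modulo
`m₀ ⋯ m_{N-1}`. -/
def cokernelMap {N : ℕ} (m : Fin N → ℤ) :
    (Fin (N + 1) → ℤ) →+ ℤ × (ℤ ⧸ AddSubgroup.zmultiples (∏ i, m i)) :=
  AddMonoidHom.mk' (fun x => (x 0, (affineRec (zeroExtend m) (zeroExtend x) 0 N : ℤ)))
    fun x y => by simp [zeroExtend_add, affineRec_add]

theorem cokernelMap_surjective {N : ℕ} (hN : N ≠ 0) (m : Fin N → ℤ) :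
    Function.Surjective (cokernelMap m) := by
  rintro ⟨a, b⟩
  obtain ⟨b, rfl⟩ := QuotientAddGroup.mk_surjective b
  obtain ⟨p, rfl⟩ := Nat.exists_eq_succ_of_ne_zero hN
  refine ⟨Fin.cons a (Pi.single (Fin.last p) b), Prod.ext rfl ?_⟩
  have hz : ∀ i ≤ p, zeroExtend (Fin.cons a (Pi.single (Fin.last p) b) : Fin (p + 2) → ℤ) (i + 1)
      = if i = p then b else 0 := by
    intro i hi
    have := zeroExtend_val (Fin.cons a (Pi.single (Fin.last p) b) : Fin (p + 2) → ℤ)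
      (Fin.succ ⟨i, by omega⟩)
    rw [Fin.cons_succ] at this
    simpa [Pi.single_apply, Fin.ext_iff] using this
  change QuotientAddGroup.mk (affineRec _ _ 0 (p + 1)) = _
  rw [affineRec, affineRec_eq_zero, hz p le_rfl]
  · simp
  · intro i hi
    rw [hz i hi.le, if_neg hi.ne]

section

variable {N : ℕ} {m : Fin N → ℤ} {δ : (Fin N → ℤ) →+ (Fin (N + 1) → ℤ)}

theorem apply_eq_iff_eq_affineRec (hδ₀ : ∀ k, δ k 0 = 0)
    (hδ : ∀ k (j : Fin N), δ k j.succ =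
      zeroExtend k (j + 1) - zeroExtend m j * zeroExtend k j)
    (k : Fin N → ℤ) (x : Fin (N + 1) → ℤ) :
    δ k = x ↔ x 0 = 0 ∧ ∀ j ≤ N, zeroExtend k j =
      affineRec (zeroExtend m) (zeroExtend x) (zeroExtend k 0) j := by
  rw [← recurrence_iff_eq_affineRec, funext_iff, Fin.forall_fin_succ, hδ₀, eq_comm (a := 0),
    Fin.forall_iff]
  refine and_congr_right fun _ => forall₂_congr fun j hj => ?_
  have := zeroExtend_val x (Fin.succ ⟨j, hj⟩)
  rw [hδ, ← this, eq_comm]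
  rfl

theorem mem_ker_iff (hδ₀ : ∀ k, δ k 0 = 0)
    (hδ : ∀ k (j : Fin N), δ k j.succ =
      zeroExtend k (j + 1) - zeroExtend m j * zeroExtend k j)
    (k : Fin N → ℤ) :
    k ∈ δ.ker ↔ ∀ j ≤ N, zeroExtend k j =
      zeroExtend k 0 * ∏ i ∈ Finset.range j, zeroExtend m i := by
  rw [AddMonoidHom.mem_ker, apply_eq_iff_eq_affineRec hδ₀ hδ]
  simp only [Pi.zero_apply, true_and]
  refine forall₂_congr fun j _ => ?_
  rw [affineRec_eq, affineRec_eq_zero, add_zero]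
  intro i _
  simp [zeroExtend]

theorem ker_eq_bot_of_prod_ne_zero (hδ₀ : ∀ k, δ k 0 = 0)
    (hδ : ∀ k (j : Fin N), δ k j.succ =
      zeroExtend k (j + 1) - zeroExtend m j * zeroExtend k j)
    (hm : ∏ i, m i ≠ 0) : δ.ker = ⊥ := by
  rw [eq_bot_iff]
  intro k hk
  rw [mem_ker_iff hδ₀ hδ] at hk
  have h := hk N le_rfl
  rw [zeroExtend_of_le k le_rfl, prod_range_zeroExtend, eq_comm, mul_eq_zero,
    or_iff_left hm] at h
  rw [AddSubgroup.mem_bot]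
  funext j
  rw [← zeroExtend_val k, hk j j.isLt.le, h]
  simp

theorem nonempty_ker_addEquiv_int (hN : N ≠ 0) (hδ₀ : ∀ k, δ k 0 = 0)
    (hδ : ∀ k (j : Fin N), δ k j.succ =
      zeroExtend k (j + 1) - zeroExtend m j * zeroExtend k j)
    (hm : ∏ i, m i = 0) : Nonempty (δ.ker ≃+ ℤ) := by
  let f : δ.ker →+ ℤ :=
    AddMonoidHom.mk' (fun k => zeroExtend (k : Fin N → ℤ) 0) fun k l => by
      simp [zeroExtend_add]
  refine ⟨AddEquiv.ofBijective f ⟨?_, fun c => ?_⟩⟩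
  · rintro ⟨k, hk⟩ ⟨l, hl⟩ (h : zeroExtend k 0 = zeroExtend l 0)
    rw [mem_ker_iff hδ₀ hδ] at hk hl
    ext j
    change k j = l j
    rw [← zeroExtend_val k, ← zeroExtend_val l, hk j j.isLt.le, hl j j.isLt.le, h]
  · let k : Fin N → ℤ := fun j => c * ∏ i ∈ Finset.range j, zeroExtend m i
    have h0 : zeroExtend k 0 = c := by simp [zeroExtend, k, Nat.pos_of_ne_zero hN]
    refine ⟨⟨k, (mem_ker_iff hδ₀ hδ k).2 fun j hj => ?_⟩, h0⟩
    rw [h0]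
    obtain hj | rfl := hj.lt_or_eq
    · simp [zeroExtend, k, hj]
    · rw [zeroExtend_of_le k le_rfl, prod_range_zeroExtend, hm, mul_zero]

theorem ker_cokernelMap (hN : N ≠ 0) (hδ₀ : ∀ k, δ k 0 = 0)
    (hδ : ∀ k (j : Fin N), δ k j.succ =
      zeroExtend k (j + 1) - zeroExtend m j * zeroExtend k j) :
    (cokernelMap m).ker = δ.range := by
  ext x
  have hker : x ∈ (cokernelMap m).ker ↔ x 0 = 0 ∧
      ∃ c : ℤ, affineRec (zeroExtend m) (zeroExtend x) c N = 0 := by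
    rw [AddMonoidHom.mem_ker, cokernelMap, AddMonoidHom.mk'_apply, Prod.mk_eq_zero,
      QuotientAddGroup.eq_zero_iff, AddSubgroup.mem_zmultiples_iff]
    refine and_congr_right fun _ => ⟨?_, ?_⟩
    · rintro ⟨c, hc⟩
      refine ⟨-c, ?_⟩
      rw [affineRec_eq, prod_range_zeroExtend, ← hc, smul_eq_mul]
      ring
    · rintro ⟨c, hc⟩
      refine ⟨-c, ?_⟩
      rw [affineRec_eq, prod_range_zeroExtend] at hc
      rw [smul_eq_mul]
      linarith
  rw [hker, AddMonoidHom.mem_range]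
  simp only [apply_eq_iff_eq_affineRec hδ₀ hδ]
  constructor
  · rintro ⟨hx, c, hc⟩
    let k : Fin N → ℤ := fun j => affineRec (zeroExtend m) (zeroExtend x) c j
    have h0 : zeroExtend k 0 = c := by
      simp [zeroExtend, k, Nat.pos_of_ne_zero hN, affineRec]
    refine ⟨k, hx, fun j hj => ?_⟩
    rw [h0]
    obtain hj | rfl := hj.lt_or_eq
    · simp [zeroExtend, k, hj]
    · rw [zeroExtend_of_le k le_rfl, hc]
  · rintro ⟨k, hx, hk⟩
    exact ⟨hx, _, (hk N le_rfl).symm.trans (zeroExtend_of_le k le_rfl)⟩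

theorem nonempty_cokernel_addEquiv (hN : N ≠ 0) (hδ₀ : ∀ k, δ k 0 = 0)
    (hδ : ∀ k (j : Fin N), δ k j.succ =
      zeroExtend k (j + 1) - zeroExtend m j * zeroExtend k j) :
    Nonempty (((Fin (N + 1) → ℤ) ⧸ δ.range) ≃+
      ℤ × (ℤ ⧸ AddSubgroup.zmultiples (∏ i, m i))) :=
  ⟨(QuotientAddGroup.quotientAddEquivOfEq (ker_cokernelMap hN hδ₀ hδ).symm).trans
    (QuotientAddGroup.quotientKerEquivOfSurjective _ (cokernelMap_surjective hN m))⟩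

end

/-- For `n ≥ 2` and integers `m₂, …, m_n` (encoded as
`m : Fin (n-1) → ℤ` with `m j = m_{j+2}`), let `δ : ℤ^{n-1} → ℤⁿ` be the group homomorphism
`δ(k₁, …, k_{n-1}) = (0, k₂ - m₂k₁, …, k_{n-1} - m_{n-1}k_{n-2}, -m_n k_{n-1})`
(in zero-based form `δ(k)ⱼ = (if 1 ≤ j < n-1 then kⱼ else 0) - (if 1 ≤ j then m_{j-1}k_{j-1} else 0)`).
Then `ker δ ≅ ℤ` if some `m_i = 0`, and `ker δ = 0` otherwise; and
`coker δ ≅ ℤ ⊕ ℤ/(m₂⋯m_n)ℤ` if all `m_i ≠ 0`, while `coker δ ≅ ℤ²` if some `m_i = 0`. -/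
theorem stmt18 (n : ℕ) (hn : 2 ≤ n) (m : Fin (n - 1) → ℤ)
    (δ : (Fin (n - 1) → ℤ) →+ (Fin n → ℤ))
    (hδ : ∀ (k : Fin (n - 1) → ℤ) (j : Fin n),
      δ k j =
        (if h : 1 ≤ (j : ℕ) ∧ (j : ℕ) < n - 1 then k ⟨(j : ℕ), h.2⟩ else 0) -
        (if h : 1 ≤ (j : ℕ) then
            m ⟨(j : ℕ) - 1, by have := j.isLt; omega⟩ *
              k ⟨(j : ℕ) - 1, by have := j.isLt; omega⟩
          else 0)) :
    -- (1) the kernel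
    ((∃ i, m i = 0) → Nonempty (δ.ker ≃+ ℤ)) ∧
    ((∀ i, m i ≠ 0) → δ.ker = ⊥) ∧
    -- (2) the cokernel
    ((∀ i, m i ≠ 0) →
      Nonempty (((Fin n → ℤ) ⧸ δ.range) ≃+
        ℤ × (ℤ ⧸ AddSubgroup.zmultiples (∏ i, m i)))) ∧
    ((∃ i, m i = 0) → Nonempty (((Fin n → ℤ) ⧸ δ.range) ≃+ ℤ × ℤ)) := by
  obtain ⟨N, rfl⟩ : ∃ N, n = N + 1 := ⟨n - 1, by omega⟩
  have hN : N ≠ 0 := by omega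
  have hδ₀ : ∀ k, δ k 0 = 0 := fun k => by rw [hδ]; simp
  have hδs : ∀ (k : Fin N → ℤ) (j : Fin N), δ k j.succ =
      zeroExtend k (j + 1) - zeroExtend (N := N) m j * zeroExtend k j := fun k j => by
    rw [hδ, zeroExtend_val, zeroExtend_val]
    simp [zeroExtend]
  have hprod : (∃ i, m i = 0) → ∏ i, m i = 0 := fun ⟨i, hi⟩ =>
    Finset.prod_eq_zero (Finset.mem_univ i) hi
  refine ⟨fun h => nonempty_ker_addEquiv_int hN hδ₀ hδs (hprod h),
    fun h => ker_eq_bot_of_prod_ne_zero hδ₀ hδs (Finset.prod_ne_zero_iff.2 fun i _ => h i),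
    fun _ => nonempty_cokernel_addEquiv hN hδ₀ hδs, fun h => ?_⟩
  obtain ⟨e⟩ := nonempty_cokernel_addEquiv hN hδ₀ hδs
  have hbot : AddSubgroup.zmultiples (∏ i, m i) = ⊥ := by
    rw [hprod h, AddSubgroup.zmultiples_zero_eq_bot]
  exact ⟨e.trans ((AddEquiv.refl ℤ).prodCongr
    ((QuotientAddGroup.quotientAddEquivOfEq hbot).trans QuotientAddGroup.quotientBot))⟩
end
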